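/- Soundness of SC_iALC for TBox reasoning: for every finite set Θ of iALC concepts and every iALC concept C, if the sequent Θ ⇒ C is derivable in the sequent calculus SC_iALC, then Θ ⊨ C, i.e., for every constructive model I of iALC in which every concept of Θ is valid, C is also valid in I. -/

import Mathlib

namespace iALC

/-- iALC concepts: C ::= A | ⊥ | ⊤ | ¬C | C⊓D | C⊔D | C⊑D | ∃R.C | ∀R.C -/
inductive Concept (A R : Type) : Type
  | atom : A → Concept A R
  | bot  : Concept A R
  | top  : Concept A R
  | neg  : Concept A R → Concept A R
  | and  : Concept A R → Concept A R → Concept A R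
  | or   : Concept A R → Concept A R → Concept A R
  | subs : Concept A R → Concept A R → Concept A R
  | ex   : R → Concept A R → Concept A R
  | all  : R → Concept A R → Concept A R
  deriving DecidableEq

/-- A constructive interpretation of iALC. -/
structure Interp (A R : Type) where
  World : Type
  nonempty : Nonempty World
  le : World → World → Prop
  le_refl : ∀ w, le w w
  le_trans : ∀ {u v w}, le u v → le v w → le u w
  rel : R → World → World → Prop
  atom : A → World → Prop
  atom_mono : ∀ a x y, atom a x → le x y → atom a y

/-- Interpretation of concepts: `I.interp C w` means `w ∈ C^I`. -/
def Interp.interp {A R : Type} (I : Interp A R) : Concept A R → I.World → Prop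
  | .atom a, w => I.atom a w
  | .bot, _ => False
  | .top, _ => True
  | .neg C, w => ∀ y, I.le w y → ¬ I.interp C y
  | .and C D, w => I.interp C w ∧ I.interp D w
  | .or C D, w => I.interp C w ∨ I.interp D w
  | .subs C D, w => ∀ y, I.le w y → I.interp C y → I.interp D y
  | .ex r C, w => ∃ y, I.rel r w y ∧ I.interp C y
  | .all r C, w => ∀ y, I.le w y → ∀ z, I.rel r y z → I.interp C z

/-- Frame conditions F1 and F2: a constructive interpretation is a model iff both hold. -/
def Interp.IsModel {A R : Type} (I : Interp A R) : Prop :=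
  (∀ r w w' v, I.le w w' → I.rel r w v → ∃ v', I.rel r w' v' ∧ I.le v v') ∧
  (∀ r w v v', I.le v v' → I.rel r w v → ∃ w', I.rel r w' v' ∧ I.le w w')

/-- A concept is valid in `I` iff it is satisfied by every element of the domain. -/
def Interp.valid {A R : Type} (I : Interp A R) (C : Concept A R) : Prop :=
  ∀ w : I.World, I.interp C w

/-- Nominal assertions: N ::= x:C | x:N (nominals are natural numbers). -/
inductive Nassert (A R : Type) : Type
  | conc : ℕ → Concept A R → Nassert A R
  | nest : ℕ → Nassert A R → Nassert A R
  deriving DecidableEq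

/-- Formulas of SC_iALC: concepts, nominal assertions, and role assertions xRy. -/
inductive Formula (A R : Type) : Type
  | concept : Concept A R → Formula A R
  | nassert : Nassert A R → Formula A R
  | rel : ℕ → R → ℕ → Formula A R
  deriving DecidableEq

/-- Nominals occurring in a nominal assertion. -/
def Nassert.noms {A R : Type} : Nassert A R → Finset ℕ
  | .conc x _ => {x}
  | .nest x n => insert x n.noms

/-- Nominals occurring in a formula. -/
def Formula.noms {A R : Type} : Formula A R → Finset ℕ
  | .concept _ => ∅
  | .nassert n => n.noms
  | .rel x _ y => {x, y}

/-- `∀R.`-prefixing: prefixes `∀R.` to concepts, leaves assertions unchanged. -/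
def Formula.allPrefix {A R : Type} (r : R) : Formula A R → Formula A R
  | .concept C => .concept (.all r C)
  | f => f

/-- `x:`-prefixing: prefixes `x:` to concepts, leaves assertions unchanged. -/
def Formula.nomPrefix {A R : Type} (x : ℕ) : Formula A R → Formula A R
  | .concept C => .nassert (.conc x C)
  | f => f

/-- The nominal assertion `x:C` as a formula. -/
def nc {A R : Type} (x : ℕ) (C : Concept A R) : Formula A R := .nassert (.conc x C)

/-- Derivability in the sequent calculus SC_iALC (sequents are `Δ ⇒ δ` with `Δ` a finite set). -/
inductive Deriv {A R : Type} [DecidableEq A] [DecidableEq R] :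
    Finset (Formula A R) → Formula A R → Prop
  | ax : ∀ Δ δ, Deriv (insert δ Δ) δ
  | botL : ∀ Δ δ, Deriv (insert (.concept .bot) Δ) δ
  | nbotL : ∀ Δ δ x, Deriv (insert (nc x .bot) Δ) δ
  -- structural rules and cut
  | weak : ∀ Δ δ f, Deriv Δ δ → Deriv (insert f Δ) δ
  | cut : ∀ Δ₁ Δ₂ φ δ, Deriv Δ₁ φ → Deriv (insert φ Δ₂) δ → Deriv (Δ₁ ∪ Δ₂) δ
  -- role quantification rules
  | allR : ∀ Δ x y r α,
      Deriv (insert (.rel x r y) Δ) (nc y α) → Deriv Δ (nc x (.all r α))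
  | allL : ∀ Δ x y r α δ,
      Deriv (insert (nc x (.all r α)) (insert (nc y α) (insert (.rel x r y) Δ))) δ →
      Deriv (insert (nc x (.all r α)) (insert (.rel x r y) Δ)) δ
  | exR : ∀ Δ x y r α,
      Deriv Δ (.rel x r y) → Deriv Δ (nc y α) → Deriv Δ (nc x (.ex r α))
  | exL : ∀ Δ x y r α δ,
      (∀ f ∈ insert (nc x (.ex r α)) Δ, y ∉ f.noms) → y ∉ δ.noms →
      Deriv (insert (.rel x r y) (insert (nc y α) Δ)) δ →
      Deriv (insert (nc x (.ex r α)) Δ) δ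
  -- propositional rules, version without nominals
  | subsR : ∀ Δ α β,
      Deriv (insert (.concept α) Δ) (.concept β) → Deriv Δ (.concept (.subs α β))
  | subsL : ∀ Δ₁ Δ₂ α β δ,
      Deriv Δ₁ (.concept α) → Deriv (insert (.concept β) Δ₂) δ →
      Deriv (insert (.concept (.subs α β)) (Δ₁ ∪ Δ₂)) δ
  | andR : ∀ Δ α β,
      Deriv Δ (.concept α) → Deriv Δ (.concept β) → Deriv Δ (.concept (.and α β))
  | andL : ∀ Δ α β δ,
      Deriv (insert (.concept α) (insert (.concept β) Δ)) δ →
      Deriv (insert (.concept (.and α β)) Δ) δ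
  | orR1 : ∀ Δ α β, Deriv Δ (.concept α) → Deriv Δ (.concept (.or α β))
  | orR2 : ∀ Δ α β, Deriv Δ (.concept β) → Deriv Δ (.concept (.or α β))
  | orL : ∀ Δ α β δ,
      Deriv (insert (.concept α) Δ) δ → Deriv (insert (.concept β) Δ) δ →
      Deriv (insert (.concept (.or α β)) Δ) δ
  -- propositional rules, version with nominals
  | nsubsR : ∀ Δ x α β,
      Deriv (insert (nc x α) Δ) (nc x β) → Deriv Δ (nc x (.subs α β))
  | nsubsL : ∀ Δ₁ Δ₂ x α β δ,
      Deriv Δ₁ (nc x α) → Deriv (insert (nc x β) Δ₂) δ →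
      Deriv (insert (nc x (.subs α β)) (Δ₁ ∪ Δ₂)) δ
  | nandR : ∀ Δ x α β,
      Deriv Δ (nc x α) → Deriv Δ (nc x β) → Deriv Δ (nc x (.and α β))
  | nandL : ∀ Δ x α β δ,
      Deriv (insert (nc x α) (insert (nc x β) Δ)) δ →
      Deriv (insert (nc x (.and α β)) Δ) δ
  | norR1 : ∀ Δ x α β, Deriv Δ (nc x α) → Deriv Δ (nc x (.or α β))
  | norR2 : ∀ Δ x α β, Deriv Δ (nc x β) → Deriv Δ (nc x (.or α β))
  | norL : ∀ Δ x α β δ,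
      Deriv (insert (nc x α) Δ) δ → Deriv (insert (nc x β) Δ) δ →
      Deriv (insert (nc x (.or α β)) Δ) δ
  -- promotion rules
  | pEx : ∀ Δ α β r,
      Deriv (insert (.concept α) Δ) (.concept β) →
      Deriv (insert (.concept (.ex r α)) (Δ.image (Formula.allPrefix r))) (.concept (.ex r β))
  | pAll : ∀ Δ α r,
      Deriv Δ (.concept α) →
      Deriv (Δ.image (Formula.allPrefix r)) (.concept (.all r α))
  | pN : ∀ Δ δ x,
      Deriv Δ δ → Deriv (Δ.image (Formula.nomPrefix x)) (Formula.nomPrefix x δ)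

theorem Interp.interp_mono {A R : Type} {I : Interp A R} (hI : I.IsModel) (C : Concept A R) :
    ∀ {w v : I.World}, I.le w v → I.interp C w → I.interp C v := by
  induction C with
  | atom a => exact fun h hw => I.atom_mono a _ _ hw h
  | bot => exact fun _ hw => hw
  | top => exact fun _ hw => hw
  | neg C _ => exact fun h hw y hy => hw y (I.le_trans h hy)
  | and C D ihC ihD => exact fun h hw => ⟨ihC h hw.1, ihD h hw.2⟩
  | or C D ihC ihD => exact fun h hw => hw.imp (ihC h) (ihD h)
  | subs C D _ _ => exact fun h hw y hy => hw y (I.le_trans h hy)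
  | ex r C ih =>
    rintro w v h ⟨y, hy, hC⟩
    obtain ⟨v', hv', hle⟩ := hI.1 r w v y h hy
    exact ⟨v', hv', ih hle hC⟩
  | all r C _ => exact fun h hw y hy => hw y (I.le_trans h hy)

/-- The interpretation with a single world, reflexive for all roles, and no true atoms. -/
def Interp.point (A R : Type) : Interp A R where
  World := Unit
  nonempty := ⟨()⟩
  le _ _ := True
  le_refl _ := trivial
  le_trans _ _ := trivial
  rel _ _ _ := True
  atom _ _ := False
  atom_mono _ _ _ h _ := h

theorem Interp.point_isModel (A R : Type) : (Interp.point A R).IsModel :=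
  ⟨fun _ _ _ _ _ _ => ⟨(), trivial, trivial⟩, fun _ _ _ _ _ _ => ⟨(), trivial, trivial⟩⟩

/-- Truth of a nominal assertion when all nominals denote the world of `Interp.point`. -/
def Nassert.holds {A R : Type} : Nassert A R → Prop
  | .conc _ C => (Interp.point A R).interp C ()
  | .nest _ n => n.holds

/-- Satisfaction of a formula: concepts are read at a world of `I`, whereas nominals denote the
world of `Interp.point`. Since that interpretation has one world, the rule `Deriv.allR` preserves
truth even though it lacks an eigenvariable condition. -/
def Formula.sat {A R : Type} (I : Interp A R) (w : I.World) : Formula A R → Prop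
  | .concept C => I.interp C w
  | .nassert n => n.holds
  | .rel _ _ _ => True

theorem Formula.sat_mono {A R : Type} {I : Interp A R} (hI : I.IsModel) {w v : I.World}
    (h : I.le w v) : ∀ {f : Formula A R}, f.sat I w → f.sat I v
  | .concept C, hf => I.interp_mono hI C h hf
  | .nassert _, hf => hf
  | .rel _ _ _, hf => hf

theorem Formula.sat_of_sat_allPrefix {A R : Type} {I : Interp A R} {r : R} {w u v : I.World}
    (hle : I.le w u) (hr : I.rel r u v) :
    ∀ {f : Formula A R}, (f.allPrefix r).sat I w → f.sat I v
  | .concept _, hf => hf _ hle _ hr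
  | .nassert _, hf => hf
  | .rel _ _ _, hf => hf

theorem Formula.sat_nomPrefix {A R : Type} {I : Interp A R} {w : I.World} {x : ℕ} :
    ∀ {f : Formula A R}, (f.nomPrefix x).sat I w ↔ f.sat (Interp.point A R) ()
  | .concept _ => Iff.rfl
  | .nassert _ => Iff.rfl
  | .rel _ _ _ => Iff.rfl

theorem Deriv.sat {A R : Type} [DecidableEq A] [DecidableEq R] {Δ : Finset (Formula A R)}
    {δ : Formula A R} (h : Deriv Δ δ) :
    ∀ (I : Interp A R), I.IsModel → ∀ w : I.World, (∀ f ∈ Δ, f.sat I w) → δ.sat I w := by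
  induction h with
  | ax Δ δ => exact fun I _ w h => h δ (Finset.mem_insert_self _ _)
  | botL Δ δ => exact fun I _ w h => (h _ (Finset.mem_insert_self _ _)).elim
  | nbotL Δ δ x =>
    intro I _ w h
    have hb : (nc x .bot : Formula A R).sat I w := h _ (Finset.mem_insert_self _ _)
    exact hb.elim
  | weak Δ δ f _ ih => exact fun I hI w h => ih I hI w fun g hg => h g (Finset.mem_insert_of_mem hg)
  | cut Δ₁ Δ₂ φ δ _ _ ih₁ ih₂ =>
    intro I hI w h
    simp only [Finset.forall_mem_union, Finset.forall_mem_insert] at *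
    exact ih₂ I hI w ⟨ih₁ I hI w h.1, h.2⟩
  | allR Δ x y r α _ ih =>
    intro I hI w h _ _ _ _
    simp only [Finset.forall_mem_insert] at *
    exact ih I hI w ⟨trivial, h⟩
  | allL Δ x y r α δ _ ih =>
    intro I hI w h
    simp only [Finset.forall_mem_insert] at *
    exact ih I hI w ⟨h.1, h.1 () trivial () trivial, h.2⟩
  | exR Δ x y r α _ _ _ ih => exact fun I hI w h => ⟨(), trivial, ih I hI w h⟩
  | exL Δ x y r α δ _ _ _ ih =>
    intro I hI w h
    simp only [Finset.forall_mem_insert] at *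
    obtain ⟨⟨_, _, hα⟩, hΔ⟩ := h
    exact ih I hI w ⟨trivial, hα, hΔ⟩
  | subsR Δ α β _ ih =>
    intro I hI w h y hy hα
    simp only [Finset.forall_mem_insert] at *
    exact ih I hI y ⟨hα, fun f hf => Formula.sat_mono hI hy (h f hf)⟩
  | subsL Δ₁ Δ₂ α β δ _ _ ih₁ ih₂ =>
    intro I hI w h
    simp only [Finset.forall_mem_union, Finset.forall_mem_insert] at *
    exact ih₂ I hI w ⟨h.1 w (I.le_refl w) (ih₁ I hI w h.2.1), h.2.2⟩
  | andR Δ α β _ _ ih₁ ih₂ => exact fun I hI w h => ⟨ih₁ I hI w h, ih₂ I hI w h⟩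
  | andL Δ α β δ _ ih =>
    intro I hI w h
    simp only [Finset.forall_mem_insert] at *
    exact ih I hI w ⟨h.1.1, h.1.2, h.2⟩
  | orR1 Δ α β _ ih => exact fun I hI w h => Or.inl (ih I hI w h)
  | orR2 Δ α β _ ih => exact fun I hI w h => Or.inr (ih I hI w h)
  | orL Δ α β δ _ _ ih₁ ih₂ =>
    intro I hI w h
    simp only [Finset.forall_mem_insert] at *
    exact h.1.elim (fun hα => ih₁ I hI w ⟨hα, h.2⟩) (fun hβ => ih₂ I hI w ⟨hβ, h.2⟩)
  | nsubsR Δ x α β _ ih =>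
    intro I hI w h _ _ hα
    simp only [Finset.forall_mem_insert] at *
    exact ih I hI w ⟨hα, h⟩
  | nsubsL Δ₁ Δ₂ x α β δ _ _ ih₁ ih₂ =>
    intro I hI w h
    simp only [Finset.forall_mem_union, Finset.forall_mem_insert] at *
    exact ih₂ I hI w ⟨h.1 () trivial (ih₁ I hI w h.2.1), h.2.2⟩
  | nandR Δ x α β _ _ ih₁ ih₂ => exact fun I hI w h => ⟨ih₁ I hI w h, ih₂ I hI w h⟩
  | nandL Δ x α β δ _ ih =>
    intro I hI w h
    simp only [Finset.forall_mem_insert] at *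
    exact ih I hI w ⟨h.1.1, h.1.2, h.2⟩
  | norR1 Δ x α β _ ih => exact fun I hI w h => Or.inl (ih I hI w h)
  | norR2 Δ x α β _ ih => exact fun I hI w h => Or.inr (ih I hI w h)
  | norL Δ x α β δ _ _ ih₁ ih₂ =>
    intro I hI w h
    simp only [Finset.forall_mem_insert] at *
    exact h.1.elim (fun hα => ih₁ I hI w ⟨hα, h.2⟩) (fun hβ => ih₂ I hI w ⟨hβ, h.2⟩)
  | pEx Δ α β r _ ih =>
    intro I hI w h
    simp only [Finset.forall_mem_insert, Finset.forall_mem_image] at *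
    obtain ⟨⟨y, hy, hα⟩, hΔ⟩ := h
    exact ⟨y, hy, ih I hI y
      ⟨hα, fun f hf => Formula.sat_of_sat_allPrefix (I.le_refl w) hy (hΔ hf)⟩⟩
  | pAll Δ α r _ ih =>
    intro I hI w h y hy z hz
    simp only [Finset.forall_mem_image] at h
    exact ih I hI z fun f hf => Formula.sat_of_sat_allPrefix hy hz (h hf)
  | pN Δ δ x _ ih =>
    intro I hI w h
    simp only [Finset.forall_mem_image, Formula.sat_nomPrefix] at h
    exact Formula.sat_nomPrefix.2 (ih _ (Interp.point_isModel A R) () fun f hf => h hf)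

/-- soundness of SC_iALC for TBox reasoning. -/
theorem scialc_sound {A R : Type} [DecidableEq A] [DecidableEq R]
    (Θ : Finset (Concept A R)) (C : Concept A R)
    (h : Deriv (Θ.image Formula.concept) (Formula.concept C)) :
    ∀ I : Interp A R, I.IsModel → (∀ D ∈ Θ, I.valid D) → I.valid C := by
  intro I hI hΘ w
  refine h.sat I hI w ?_
  rw [Finset.forall_mem_image]
  exact fun D hD => hΘ D hD w

end iALC
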